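/- arXiv:1705.03851 — 3 statements merged into one kernel-verified Lean document; each statement's English description precedes it below -/
import Mathlib

section
/- Let T: 𝕋 → 𝕋 be continuous with finite fibers and X ⊂ 𝕋 an infinite rotational proper subset. Then the dynamical system (X, T|_X) is uniquely ergodic: it admits exactly one T-invariant Borel probability measure. -/
open Set Filter MeasureTheory
noncomputable def rep (z : UnitAddCircle) : ℝ := (AddCircle.equivIco 1 0 z : ℝ)

def MinimalOn (T : UnitAddCircle → UnitAddCircle) (X : Set UnitAddCircle) : Prop :=
  ∀ x ∈ X, ∀ y ∈ X, y ∈ closure {z : UnitAddCircle | ∃ n : ℕ, T^[n] x = z}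

def PreservesCyclicOrder (T : UnitAddCircle → UnitAddCircle) (X : Set UnitAddCircle) : Prop :=
  ∀ p ∈ X, ∀ q ∈ X, ∀ r ∈ X,
    T p ≠ T q → T q ≠ T r → T r ≠ T p →
    sbtw p q r → sbtw (T p) (T q) (T r)

def IsRotational (T : UnitAddCircle → UnitAddCircle) (X : Set UnitAddCircle) : Prop :=
  IsClosed X ∧ Set.MapsTo T X X ∧ MinimalOn T X ∧ PreservesCyclicOrder T X

lemma rep_mem (z : UnitAddCircle) : 0 ≤ rep z ∧ rep z < 1 := by
  have := (AddCircle.equivIco 1 0 z).2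
  simpa [rep] using this

lemma coe_rep (z : UnitAddCircle) : ((rep z : ℝ) : UnitAddCircle) = z :=
  (AddCircle.equivIco 1 0).symm_apply_apply z

lemma rep_coe (t : ℝ) (h0 : 0 ≤ t) (h1 : t < 1) : rep (t : UnitAddCircle) = t := by
  have := AddCircle.coe_equivIco_mk_apply (p := (1:ℝ)) (x := t)
  unfold rep
  rw [this]
  simpa using (Int.fract_eq_self.2 ⟨h0, h1⟩)

lemma rep_inj {x y : UnitAddCircle} (h : rep x = rep y) : x = y := by
  rw [← coe_rep x, ← coe_rep y, h]

lemma measurable_rep : Measurable rep :=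
  measurable_subtype_coe.comp (AddCircle.measurableEquivIco 1 0).measurable

lemma sbtw_rep (x z y : UnitAddCircle) : sbtw x z y ↔
    (rep x < rep z ∧ rep z < rep y) ∨ (rep z < rep y ∧ rep y < rep x) ∨
    (rep y < rep x ∧ rep x < rep z) := by
  rw [sbtw_iff_not_btw]
  obtain ⟨x0, x1⟩ := rep_mem x
  obtain ⟨y0, y1⟩ := rep_mem y
  obtain ⟨z0, z1⟩ := rep_mem z
  have key : btw y z x ↔ toIcoMod (one_pos : (0:ℝ) < 1) (rep y) (rep z) ≤ toIocMod (one_pos : (0:ℝ) < 1) (rep y) (rep x) := by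
    have := @QuotientAddGroup.btw_coe_iff ℝ _ _ _ _ 1 ⟨one_pos⟩ (rep y) (rep z) (rep x)
    rw [← this]
    conv_lhs => rw [← coe_rep y, ← coe_rep z, ← coe_rep x]
  have h1 : toIcoMod (one_pos : (0:ℝ) < 1) (rep y) (rep z) = if rep y ≤ rep z then rep z else rep z + 1 := by
    rw [toIcoMod_eq_iff]
    split_ifs with h
    · exact ⟨⟨h, by linarith⟩, 0, by simp⟩
    · exact ⟨⟨by linarith, by linarith⟩, -1, by simp⟩
  have h2 : toIocMod (one_pos : (0:ℝ) < 1) (rep y) (rep x) = if rep y < rep x then rep x else rep x + 1 := by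
    rw [toIocMod_eq_iff]
    split_ifs with h
    · exact ⟨⟨h, by linarith⟩, 0, by simp⟩
    · exact ⟨⟨by linarith, by linarith⟩, -1, by simp⟩
  rw [key, h1, h2]
  split_ifs <;> constructor <;> grind

def IsInvMeas (T : UnitAddCircle → UnitAddCircle) (X : Set UnitAddCircle) (μ : Measure UnitAddCircle) : Prop :=
  IsProbabilityMeasure μ ∧ μ Xᶜ = 0 ∧
        ∀ s : Set UnitAddCircle, MeasurableSet s → μ (T ⁻¹' s) = μ s

lemma measure_level_zero (m : Measure ℝ) [IsProbabilityMeasure m] [NullSingletonClass m] (v : ℝ) :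
    m {t | ProbabilityTheory.cdf m t = v} = 0 := by
  have hm : MeasurableSet {t | ProbabilityTheory.cdf m t = v} :=
    (ProbabilityTheory.monotone_cdf m).measurable (measurableSet_singleton v)
  by_contra hne
  obtain ⟨K, hK, hKc, hpos⟩ := hm.exists_lt_isCompact (pos_iff_ne_zero.2 hne)
  have hKne : K.Nonempty := by
    rcases K.eq_empty_or_nonempty with h | h
    · simp [h] at hpos
    · exact h
  have hsub : K ⊆ Icc (sInf K) (sSup K) := fun t ht =>
    ⟨csInf_le hKc.bddBelow ht, le_csSup hKc.bddAbove ht⟩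
  have ha := hK (hKc.sInf_mem hKne)
  have hb := hK (hKc.sSup_mem hKne)
  have : m (Icc (sInf K) (sSup K)) = 0 := by
    rw [← measure_congr (Ioc_ae_eq_Icc (μ := m)), ← ProbabilityTheory.measure_cdf m,
      StieltjesFunction.measure_Ioc]
    simp only [mem_ofPred_eq] at ha hb
    simp [ha, hb]
  exact absurd (measure_mono_null hsub this) hpos.ne'

lemma continuous_cdf (m : Measure ℝ) [IsProbabilityMeasure m] [NullSingletonClass m] :
    Continuous (ProbabilityTheory.cdf m) := by
  rw [continuous_iff_continuousAt]
  intro a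
  rw [(ProbabilityTheory.monotone_cdf m).continuousAt_iff_leftLim_eq_rightLim,
    StieltjesFunction.rightLim_eq]
  have h := StieltjesFunction.measure_singleton (ProbabilityTheory.cdf m) a
  rw [ProbabilityTheory.measure_cdf, measure_singleton] at h
  have h1 := (ENNReal.ofReal_eq_zero).1 h.symm
  have h2 := (ProbabilityTheory.monotone_cdf m).leftLim_le (le_refl a)
  linarith
noncomputable def emp (u : ℕ → UnitAddCircle) (n : ℕ) : Measure UnitAddCircle :=
  ((n + 1 : ℕ) : ENNReal)⁻¹ • ∑ i ∈ Finset.range (n+1), Measure.dirac (u i)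

lemma emp_prob (u : ℕ → UnitAddCircle) (n : ℕ) : IsProbabilityMeasure (emp u n) := by
  constructor
  simp only [emp, Measure.smul_apply, Measure.finsetSum_apply, measure_univ, Finset.sum_const, Finset.card_range, smul_eq_mul, nsmul_eq_mul, mul_one]
  exact ENNReal.inv_mul_cancel (by simp) (by simp)

lemma emp_int (u : ℕ → UnitAddCircle) (n : ℕ) (f : UnitAddCircle → ℝ) :
    ∫ x, f x ∂(emp u n) = ((n:ℝ) + 1)⁻¹ * ∑ i ∈ Finset.range (n+1), f (u i) := by
  rw [emp, integral_smul_measure, integral_finsetSum_measure]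
  · simp [ENNReal.toReal_inv]
    left
    norm_cast
  · intro i _
    exact (integrable_dirac (by finiteness))

lemma exists_inv (T : UnitAddCircle → UnitAddCircle) (hT : Continuous T)
    (X : Set UnitAddCircle) (hX : IsClosed X) (hm : MapsTo T X X) (hne : X.Nonempty) :
    ∃ μ, IsInvMeas T X μ := by
  obtain ⟨x, hx⟩ := hne
  set u : ℕ → UnitAddCircle := fun i => T^[i] x with hu
  have huX : ∀ i, u i ∈ X := fun i => hm.iterate i hx
  let P : ℕ → ProbabilityMeasure UnitAddCircle := fun n => ⟨emp u n, emp_prob u n⟩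
  let U : Filter ℕ := hyperfilter ℕ
  obtain ⟨μ, -, hμ⟩ := isCompact_univ.ultrafilter_le_nhds ((hyperfilter ℕ).map P) (by simp)
  have hU : Tendsto P U (nhds μ) := hμ
  have hUat : U ≤ atTop := by
    have := hyperfilter_le_cofinite (α := ℕ)
    rwa [Nat.cofinite_eq_atTop] at this
  refine ⟨μ, inferInstance, ?_, ?_⟩
  · have h := ProbabilityMeasure.le_liminf_measure_open_of_tendsto hU hX.isOpen_compl
    have h0 : ∀ n, (P n : Measure UnitAddCircle) Xᶜ = 0 := by
      intro n
      change emp u n Xᶜ = 0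
      simp only [emp, Measure.smul_apply, Measure.finsetSum_apply, smul_eq_mul]
      rw [Finset.sum_eq_zero, mul_zero]
      intro i _
      rw [Measure.dirac_apply' _ hX.isOpen_compl.measurableSet]
      simp [huX i]
    simp only [h0, liminf_const] at h
    exact le_antisymm h (zero_le)
  · have hmap : (μ : Measure UnitAddCircle).map T = μ := by
      have : IsProbabilityMeasure ((μ : Measure UnitAddCircle).map T) :=
        Measure.isProbabilityMeasure_map hT.measurable.aemeasurable
      apply ext_of_forall_integral_eq_of_IsFiniteMeasure
      intro f
      rw [integral_map hT.measurable.aemeasurable f.continuous.aestronglyMeasurable]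
      have hw := ProbabilityMeasure.tendsto_iff_forall_integral_tendsto.1 hU
      have h1 := hw f
      have h2 := hw (f.compContinuous ⟨T, hT⟩)
      have h3 := h2.sub h1
      have h4 : Tendsto (fun n => ∫ x, (f.compContinuous ⟨T, hT⟩) x ∂(P n : Measure UnitAddCircle) - ∫ x, f x ∂(P n : Measure UnitAddCircle)) U (nhds 0) := by
        refine Tendsto.mono_left ?_ hUat
        have hb : ∀ n : ℕ, ‖∫ x, (f.compContinuous ⟨T, hT⟩) x ∂(P n : Measure UnitAddCircle) - ∫ x, f x ∂(P n : Measure UnitAddCircle)‖ ≤ (2 * ‖f‖) * ((1:ℝ) / ((n:ℝ)+1)) := by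
          intro n
          change ‖∫ x, (f.compContinuous ⟨T, hT⟩) x ∂(emp u n) - ∫ x, f x ∂(emp u n)‖ ≤ _
          rw [emp_int, emp_int, ← mul_sub,
            ← Finset.sum_sub_distrib]
          have : ∀ i, (f.compContinuous ⟨T, hT⟩) (u i) = f (u (i+1)) := by
            intro i
            simp [hu, Function.iterate_succ_apply']
          simp only [this]
          rw [Finset.sum_range_sub (fun i => f (u i)), norm_mul, norm_inv, mul_comm, one_div]
          have e : ‖(n:ℝ)+1‖ = (n:ℝ)+1 := by
            rw [Real.norm_eq_abs, abs_of_pos (by positivity)]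
          rw [e]
          gcongr
          calc _ ≤ ‖f (u (n+1))‖ + ‖f (u 0)‖ := norm_sub_le _ _
            _ ≤ ‖f‖ + ‖f‖ := add_le_add (f.norm_coe_le_norm _) (f.norm_coe_le_norm _)
            _ = _ := by ring
        refine squeeze_zero_norm hb ?_
        simpa using (tendsto_one_div_add_atTop_nhds_zero_nat (𝕜 := ℝ)).const_mul (2 * ‖f‖)
      have := tendsto_nhds_unique h3 h4
      simpa [sub_eq_zero] using this
    intro s hs
    conv_rhs => rw [← hmap]
    rw [Measure.map_apply hT.measurable hs]

lemma IsInvMeas.nullSingleton {T : UnitAddCircle → UnitAddCircle} {X : Set UnitAddCircle}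
    {μ : Measure UnitAddCircle} (h : IsInvMeas T X μ) (hmin : MinimalOn T X) (hinf : X.Infinite) :
    NullSingletonClass μ := by
  obtain ⟨hp, hX, hi⟩ := h
  constructor
  intro x
  by_contra hne
  have hxX : x ∈ X := by
    by_contra hx
    exact hne (measure_mono_null (by simpa using hx) hX)
  have hmass : ∀ n : ℕ, μ {x} ≤ μ {T^[n] x} := by
    intro n
    induction n with
    | zero => simp
    | succ n ih =>
      refine ih.trans ?_
      rw [← hi {T^[n+1] x} (measurableSet_singleton _)]
      apply measure_mono
      simp [Function.iterate_succ_apply']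
  set O : Set UnitAddCircle := {z | ∃ n : ℕ, T^[n] x = z} with hO
  by_cases hfin : O.Finite
  · apply hinf
    apply hfin.subset
    intro y hy
    have := hmin x hxX y hy
    rwa [hfin.isClosed.closure_eq] at this
  · have : μ O = ⊤ := Set.Infinite.meas_eq_top hfin ⟨μ {x}, hne, by
      rintro z ⟨n, rfl⟩; exact hmass n⟩
    exact measure_ne_top μ O this

/-- the distribution function of a measure on the circle -/
noncomputable def Phi (μ : Measure UnitAddCircle) (z : UnitAddCircle) : ℝ :=
  ProbabilityTheory.cdf (μ.map rep) (rep z)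

noncomputable def Psi (μ : Measure UnitAddCircle) (z : UnitAddCircle) : UnitAddCircle :=
  ((Phi μ z : ℝ) : UnitAddCircle)

lemma map_prob (μ : Measure UnitAddCircle) [IsProbabilityMeasure μ] :
    IsProbabilityMeasure (μ.map rep) :=
  Measure.isProbabilityMeasure_map measurable_rep.aemeasurable

lemma map_null (μ : Measure UnitAddCircle) [NullSingletonClass μ] :
    NullSingletonClass (μ.map rep) := by
  constructor
  intro t
  rw [Measure.map_apply measurable_rep (measurableSet_singleton t)]
  apply Set.Subsingleton.measure_zero
  intro a ha b hb
  exact rep_inj (by rw [show rep a = t from ha, show rep b = t from hb])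

lemma measurable_Phi (μ : Measure UnitAddCircle) : Measurable (Phi μ) :=
  (ProbabilityTheory.monotone_cdf _).measurable.comp measurable_rep

lemma measurable_Psi (μ : Measure UnitAddCircle) : Measurable (Psi μ) :=
  (AddCircle.measurable_mk').comp (measurable_Phi μ)

lemma Phi_level (μ : Measure UnitAddCircle) [IsProbabilityMeasure μ] [NullSingletonClass μ]
    (v : ℝ) : μ {z | Phi μ z = v} = 0 := by
  have := map_prob μ
  have := map_null μ
  have h := measure_level_zero (μ.map rep) v
  rwa [Measure.map_apply measurable_rep] at h
  exact (ProbabilityTheory.monotone_cdf _).measurable (measurableSet_singleton v)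

lemma map_Ioc (μ : Measure UnitAddCircle) [IsProbabilityMeasure μ] [NullSingletonClass μ]
    (x y : UnitAddCircle) (h : rep x ≤ rep y) :
    (μ.map rep).real (Ioc (rep x) (rep y)) = Phi μ y - Phi μ x := by
  have := map_prob μ
  rw [measureReal_def, ← ProbabilityTheory.measure_cdf (μ.map rep),
      StieltjesFunction.measure_Ioc, ENNReal.toReal_ofReal]
  · rfl
  · exact sub_nonneg.2 (ProbabilityTheory.monotone_cdf _ h)

lemma arc_set_lt (x y : UnitAddCircle) (h : rep x < rep y) :
    {z | sbtw x z y} = rep ⁻¹' (Ioo (rep x) (rep y)) := by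
  ext z
  simp only [mem_ofPred_eq, sbtw_rep, mem_preimage, mem_Ioo]
  grind

lemma arc_set_gt (x y : UnitAddCircle) (h : rep y < rep x) :
    {z | sbtw x z y} = rep ⁻¹' (Icc (rep y) (rep x))ᶜ := by
  ext z
  simp only [mem_ofPred_eq, sbtw_rep, mem_preimage, mem_compl_iff, mem_Icc]
  grind

lemma measurable_arc (x y : UnitAddCircle) (h : x ≠ y) : MeasurableSet {z | sbtw x z y} := by
  rcases lt_trichotomy (rep x) (rep y) with h1 | h1 | h1
  · rw [arc_set_lt x y h1]; exact measurable_rep measurableSet_Ioo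
  · exact absurd (rep_inj h1) h
  · rw [arc_set_gt x y h1]; exact measurable_rep measurableSet_Icc.compl

lemma arc_measure (μ : Measure UnitAddCircle) [IsProbabilityMeasure μ] [NullSingletonClass μ]
    (x y : UnitAddCircle) (h : x ≠ y) :
    μ.real {z | sbtw x z y} = Phi μ y - Phi μ x + if rep y < rep x then 1 else 0 := by
  have := map_prob μ
  have := map_null μ
  rcases lt_trichotomy (rep x) (rep y) with h1 | h1 | h1
  · rw [arc_set_lt x y h1, ← map_measureReal_apply measurable_rep measurableSet_Ioo,
      measureReal_congr Ioo_ae_eq_Ioc, map_Ioc μ x y h1.le, if_neg h1.not_gt, add_zero]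
  · exact absurd (rep_inj h1) h
  · rw [arc_set_gt x y h1, ← map_measureReal_apply measurable_rep measurableSet_Icc.compl,
      probReal_compl_eq_one_sub measurableSet_Icc,
      ← measureReal_congr Ioc_ae_eq_Icc, map_Ioc μ y x h1.le, if_pos h1]
    ring

lemma equivariant {T : UnitAddCircle → UnitAddCircle} {X : Set UnitAddCircle}
    {μ : Measure UnitAddCircle} (h : IsInvMeas T X μ) [NullSingletonClass μ]
    (hord : PreservesCyclicOrder T X) {x y : UnitAddCircle} (hx : x ∈ X) (hy : y ∈ X)
    (hxy : T x ≠ T y) : Psi μ (T y) - Psi μ (T x) = Psi μ y - Psi μ x := by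
  obtain ⟨hp, hX, hi⟩ := h
  have hle : ∀ x ∈ X, ∀ y ∈ X, T x ≠ T y →
      μ.real {z | sbtw x z y} ≤ μ.real {z | sbtw (T x) z (T y)} := by
    intro x hx y hy hxy
    have hsub : {z | sbtw x z y} ⊆ T ⁻¹' {z | sbtw (T x) z (T y)} ∪
        (T ⁻¹' {T x} ∪ T ⁻¹' {T y} ∪ Xᶜ) := by
      intro z hz
      by_cases hzX : z ∈ X
      · by_cases h1 : T z = T x
        · right; left; left; exact h1
        · by_cases h2 : T z = T y
          · right; left; right; exact h2
          · left
            exact hord x hx z hzX y hy (Ne.symm h1) h2 (Ne.symm hxy) hz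
      · right; right; exact hzX
    have hnull : μ (T ⁻¹' {T x} ∪ T ⁻¹' {T y} ∪ Xᶜ) = 0 := by
      simp [hi, hX]
    have h1 : μ {z | sbtw x z y} ≤ μ {z | sbtw (T x) z (T y)} := by
      refine (measure_mono hsub).trans ((measure_union_le _ _).trans ?_)
      rw [hnull, add_zero, hi _ (measurable_arc _ _ hxy)]
    exact ENNReal.toReal_mono (measure_ne_top _ _) h1
  have hne : x ≠ y := fun e => hxy (by rw [e])
  have h1 := hle x hx y hy hxy
  have h2 := hle y hy x hx hxy.symm
  rw [arc_measure μ _ _ hne, arc_measure μ _ _ hxy] at h1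
  rw [arc_measure μ _ _ hne.symm, arc_measure μ _ _ hxy.symm] at h2
  have hr : rep x ≠ rep y := fun e => hne (rep_inj e)
  have hr2 : rep (T x) ≠ rep (T y) := fun e => hxy (rep_inj e)
  have : ∃ n : ℤ, (Phi μ (T y) - Phi μ (T x)) - (Phi μ y - Phi μ x) = n := by
    rcases lt_or_gt_of_ne hr with a | a <;> rcases lt_or_gt_of_ne hr2 with b | b <;>
      simp only [a, b, a.not_gt, b.not_gt, if_true, if_false] at h1 h2
    · exact ⟨0, by push_cast; linarith⟩
    · exact ⟨-1, by push_cast; linarith⟩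
    · exact ⟨1, by push_cast; linarith⟩
    · exact ⟨0, by push_cast; linarith⟩
  obtain ⟨n, hn⟩ := this
  rw [← sub_eq_zero]
  simp only [Psi, ← AddCircle.coe_sub]
  rw [hn, AddCircle.coe_eq_zero_iff]
  exact ⟨n, by simp⟩

lemma ae_equivariant {T : UnitAddCircle → UnitAddCircle} {X : Set UnitAddCircle}
    {μ : Measure UnitAddCircle} (h : IsInvMeas T X μ) [NullSingletonClass μ]
    (hord : PreservesCyclicOrder T X) {x : UnitAddCircle} (hx : x ∈ X) :
    ∀ᵐ y ∂μ, y ∈ X ∧ Psi μ (T y) = Psi μ y + (Psi μ (T x) - Psi μ x) := by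
  have h1 : ∀ᵐ y ∂μ, y ∈ X := by
    rw [ae_iff]; exact h.2.1
  have h2 : ∀ᵐ y ∂μ, T x ≠ T y := by
    rw [ae_iff]
    refine measure_mono_null ?_ (show μ (T ⁻¹' {T x}) = 0 by
      rw [h.2.2 _ (measurableSet_singleton _), measure_singleton])
    intro y hy
    simp at hy
    exact hy.symm
  filter_upwards [h1, h2] with y hy1 hy2
  refine ⟨hy1, ?_⟩
  have := equivariant h hord hx hy1 hy2
  rw [sub_eq_iff_eq_add] at this
  rw [this]; abel

lemma not_torsion {T : UnitAddCircle → UnitAddCircle} (hT : Continuous T) {X : Set UnitAddCircle}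
    {μ : Measure UnitAddCircle} (h : IsInvMeas T X μ) [NullSingletonClass μ]
    (hmin : MinimalOn T X)
    (a : UnitAddCircle) (ha : ∀ᵐ y ∂μ, y ∈ X ∧ Psi μ (T y) = Psi μ y + a)
    (k : ℤ) (hk : k ≠ 0) : k • a ≠ 0 := by
  intro hka
  have hp := h.1
  have := map_prob μ
  have := map_null μ
  have hmp : MeasurePreserving T μ μ := ⟨hT.measurable, by
    ext s hs
    rw [Measure.map_apply hT.measurable hs, h.2.2 s hs]⟩
  have hall : ∀ᵐ y ∂μ, ∀ n : ℕ, T^[n] y ∈ X ∧ Psi μ (T (T^[n] y)) = Psi μ (T^[n] y) + a := by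
    rw [ae_all_iff]
    intro n
    exact (hmp.iterate n).quasiMeasurePreserving.ae ha
  obtain ⟨y, hy⟩ := hall.exists
  have hyX : y ∈ X := (hy 0).1
  have horb : ∀ n : ℕ, k • Psi μ (T^[n] y) = k • Psi μ y := by
    intro n
    induction n with
    | zero => rfl
    | succ n ih => rw [Function.iterate_succ_apply', (hy n).2, smul_add, hka, add_zero, ih]
  set V : Set ℝ := {v | k • (v : UnitAddCircle) = k • Psi μ y} with hV
  have hVc : IsClosed V :=
    isClosed_eq ((AddCircle.continuous_mk' 1).zsmul k) continuous_const
  have hVcount : V.Countable := by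
    refine (countable_range (fun n : ℤ => ((n : ℝ) + k * Phi μ y) / k)).mono ?_
    intro v hv
    have hv' : k • (v : UnitAddCircle) = k • ((Phi μ y : ℝ) : UnitAddCircle) := hv
    rw [← AddCircle.coe_zsmul, ← AddCircle.coe_zsmul, ← sub_eq_zero, ← AddCircle.coe_sub,
      AddCircle.coe_eq_zero_iff] at hv'
    obtain ⟨n, hn⟩ := hv'
    have hk' : (k : ℝ) ≠ 0 := by exact_mod_cast hk
    refine ⟨n, ?_⟩
    simp at hn
    field_simp
    linarith
  have hnull : μ (⋃ v ∈ V, {z | Phi μ z = v}) = 0 :=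
    (measure_biUnion_null_iff hVcount).2 fun v _ => Phi_level μ v
  have hsub : X ⊆ {0} ∪ ⋃ v ∈ V, {z | Phi μ z = v} := by
    intro z hz
    by_cases hz0 : z = 0
    · left; exact hz0
    · right
      have hcont : ContinuousAt (Phi μ) z := by
        apply (continuous_cdf (μ.map rep)).continuousAt.comp
        exact continuousAt_subtype_val.comp (AddCircle.continuousAt_equivIco 1 0 (by simpa using hz0))
      have hcl := hmin y hyX z hz
      have h3 := hcont.continuousWithinAt.mem_closure_image hcl
      have h4 : Phi μ z ∈ V := by
        refine closure_minimal ?_ hVc h3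
        rintro _ ⟨_, ⟨n, rfl⟩, rfl⟩
        exact horb n
      simp only [mem_iUnion]
      exact ⟨_, h4, rfl⟩
  have h0 : μ X = 0 := measure_mono_null hsub (measure_union_null (measure_singleton 0) hnull)
  have h1 : μ univ ≤ μ X + μ Xᶜ := by
    rw [← union_compl_self X]; exact measure_union_le _ _
  rw [h0, h.2.1] at h1
  simp at h1

lemma ext_fourier {P Q : Measure UnitAddCircle} [IsProbabilityMeasure P] [IsProbabilityMeasure Q]
    (h : ∀ k : ℤ, k ≠ 0 → ∫ x, fourier k x ∂P = ∫ x, fourier k x ∂Q) : P = Q := by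
  have hall : ∀ f : C(UnitAddCircle, ℂ), ∫ x, f x ∂P = ∫ x, f x ∂Q := by
    have hintegr : ∀ (η : Measure UnitAddCircle) [IsProbabilityMeasure η] (f : C(UnitAddCircle, ℂ)),
        Integrable f η := fun η _ f =>
      f.continuous.integrable_of_hasCompactSupport (HasCompactSupport.of_compactSpace _)
    have hcont : ∀ (η : Measure UnitAddCircle) [IsProbabilityMeasure η],
        Continuous (fun f : C(UnitAddCircle, ℂ) => ∫ x, f x ∂η) := by
      intro η _
      refine LipschitzWith.continuous (K := 1) (LipschitzWith.of_dist_le_mul fun f g => ?_)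
      rw [dist_eq_norm, ← integral_sub (hintegr η f) (hintegr η g), NNReal.coe_one, one_mul, dist_eq_norm]
      refine (norm_integral_le_of_norm_le_const (C := ‖f - g‖) ?_).trans ?_
      · exact Eventually.of_forall fun x => (f - g).norm_coe_le_norm x
      · simp
    have hcl : IsClosed {f : C(UnitAddCircle, ℂ) | ∫ x, f x ∂P = ∫ x, f x ∂Q} :=
      isClosed_eq (hcont P) (hcont Q)
    intro f
    have hf : f ∈ (Submodule.span ℂ (range <| @fourier 1)).topologicalClosure := by
      rw [span_fourier_closure_eq_top]; trivial
    refine closure_minimal ?_ hcl hf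
    intro g hg
    refine Submodule.span_induction (p := fun g _ => ∫ x, g x ∂P = ∫ x, g x ∂Q) ?_ ?_ ?_ ?_ hg
    · rintro _ ⟨k, rfl⟩
      by_cases hk : k = 0
      · subst hk; simp
      · exact h k hk
    · simp
    · intro f g _ _ hf hg
      simp only [ContinuousMap.add_apply]
      rw [integral_add (hintegr P f) (hintegr P g), integral_add (hintegr Q f) (hintegr Q g), hf, hg]
    · intro c f _ hf
      simp only [ContinuousMap.smul_apply]
      rw [integral_smul, integral_smul, hf]
  apply ext_of_forall_integral_eq_of_IsFiniteMeasure
  intro f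
  have := hall ⟨fun x => (f x : ℂ), by fun_prop⟩
  simp only [ContinuousMap.coe_mk] at this
  rw [integral_complex_ofReal, integral_complex_ofReal] at this
  exact_mod_cast this

lemma fourier_zero_int {T : UnitAddCircle → UnitAddCircle} (hT : Continuous T)
    {X : Set UnitAddCircle} {μ : Measure UnitAddCircle} (h : IsInvMeas T X μ)
    (g : UnitAddCircle → UnitAddCircle) (hg : Measurable g) (a : UnitAddCircle)
    (ha : ∀ᵐ y ∂μ, g (T y) = g y + a) (k : ℤ) (hk : k • a ≠ 0) :
    ∫ x, fourier k x ∂(μ.map g) = 0 := by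
  have hp := h.1
  have hmap : μ.map T = μ := by
    ext s hs
    rw [Measure.map_apply hT.measurable hs, h.2.2 s hs]
  rw [integral_map hg.aemeasurable (map_continuous _).aestronglyMeasurable]
  have hm : Measurable (fun y => fourier k (g y)) := (map_continuous (fourier k)).measurable.comp hg
  have h1 : ∫ y, fourier k (g y) ∂μ = ∫ y, fourier k (g (T y)) ∂μ := by
    conv_lhs => rw [← hmap]
    rw [integral_map hT.measurable.aemeasurable hm.aestronglyMeasurable]
  have h2 : ∫ y, fourier k (g (T y)) ∂μ = ∫ y, fourier k (g y) * fourier k a ∂μ := by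
    apply integral_congr_ae
    filter_upwards [ha] with y hy
    rw [hy]
    simp [fourier_apply, smul_add, AddCircle.toCircle_add]
  rw [h2, integral_mul_const] at h1
  have h3 : (fourier k a : ℂ) ≠ 1 := by
    intro e
    apply hk
    rw [fourier_apply] at e
    apply AddCircle.injective_toCircle (T := 1) one_ne_zero
    rw [AddCircle.toCircle_zero]
    exact Subtype.ext e
  have h4 : (∫ y, fourier k (g y) ∂μ) * (fourier k a - 1) = 0 := by
    rw [mul_sub, ← h1]; simp
  exact (mul_eq_zero.1 h4).resolve_right (sub_ne_zero.2 h3)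

lemma invMeas_unique {T : UnitAddCircle → UnitAddCircle} (hT : Continuous T)
    {X : Set UnitAddCircle} (hrot : IsRotational T X) (hinf : X.Infinite)
    {μ ν : Measure UnitAddCircle} (hμ : IsInvMeas T X μ) (hν : IsInvMeas T X ν) : μ = ν := by
  obtain ⟨hcl, hmaps, hmin, hord⟩ := hrot
  obtain ⟨x0, hx0⟩ := hinf.nonempty
  have pμ := hμ.1
  have pν := hν.1
  set l : Measure UnitAddCircle := (2⁻¹ : ENNReal) • (μ + ν) with hl
  have hlinv : IsInvMeas T X l := by
    refine ⟨⟨?_⟩, ?_, ?_⟩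
    · simp only [hl, Measure.smul_apply, Measure.add_apply, measure_univ, smul_eq_mul]
      rw [one_add_one_eq_two]
      exact ENNReal.inv_mul_cancel (by simp) (by simp)
    · simp [hl, hμ.2.1, hν.2.1]
    · intro s hs
      simp [hl, hμ.2.2 s hs, hν.2.2 s hs]
  have pl := hlinv.1
  have nl := hlinv.nullSingleton hmin hinf
  have acμ : μ ≪ l := by
    intro s hs
    simp [hl] at hs
    exact hs.1
  have acν : ν ≪ l := by
    intro s hs
    simp [hl] at hs
    exact hs.2
  set a := Psi l (T x0) - Psi l x0 with haa
  have ha := ae_equivariant hlinv hord hx0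
  have htor := not_torsion hT hlinv hmin a ha
  have hf : ∀ η : Measure UnitAddCircle, IsInvMeas T X η → η ≪ l → ∀ k : ℤ, k ≠ 0 →
      ∫ x, fourier k x ∂(η.map (Psi l)) = 0 := by
    intro η hη hac k hk
    refine fourier_zero_int hT hη _ (measurable_Psi l) a ?_ k (htor k hk)
    filter_upwards [hac.ae_le ha] with y hy using hy.2
  have e : μ.map (Psi l) = ν.map (Psi l) := by
    have := Measure.isProbabilityMeasure_map (μ := μ) (measurable_Psi l).aemeasurable
    have := Measure.isProbabilityMeasure_map (μ := ν) (measurable_Psi l).aemeasurable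
    apply ext_fourier
    intro k hk
    rw [hf μ hμ acμ k hk, hf ν hν acν k hk]
  -- compare on initial arcs
  have hle1 : ∀ z, Phi l z ≤ 1 := fun z => ProbabilityTheory.cdf_le_one _ _
  have hge0 : ∀ z, 0 ≤ Phi l z := fun z => ProbabilityTheory.cdf_nonneg _ _
  have harc : ∀ t : ℝ, ∃ B : Set UnitAddCircle, MeasurableSet B ∧
      rep ⁻¹' (Iic t) =ᵐ[l] Psi l ⁻¹' B := by
    intro t
    set v := ProbabilityTheory.cdf (l.map rep) t with hv
    refine ⟨rep ⁻¹' (Iic v), measurable_rep measurableSet_Iic, ?_⟩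
    have n1 : ∀ᵐ z ∂l, Phi l z ≠ v := by
      rw [ae_iff]; simpa using Phi_level l v
    have n2 : ∀ᵐ z ∂l, Phi l z ≠ 1 := by
      rw [ae_iff]; simpa using Phi_level l 1
    filter_upwards [n1, n2] with z h1 h2
    have hz : rep (Psi l z) = Phi l z := rep_coe _ (hge0 z) (lt_of_le_of_ne (hle1 z) h2)
    apply propext
    change rep z ≤ t ↔ rep (Psi l z) ≤ v
    rw [hz]
    constructor
    · intro h
      exact ProbabilityTheory.monotone_cdf _ h
    · intro h
      by_contra hlt
      push Not at hlt
      exact h1 (le_antisymm h (ProbabilityTheory.monotone_cdf _ hlt.le))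
  have erep : μ.map rep = ν.map rep := by
    have := map_prob μ
    have := map_prob ν
    apply Measure.ext_of_Iic
    intro t
    obtain ⟨B, hB, hBe⟩ := harc t
    rw [Measure.map_apply measurable_rep measurableSet_Iic,
      Measure.map_apply measurable_rep measurableSet_Iic,
      measure_congr (acμ.ae_le hBe), measure_congr (acν.ae_le hBe),
      ← Measure.map_apply (measurable_Psi l) hB, ← Measure.map_apply (measurable_Psi l) hB, e]
  have hback : ∀ η : Measure UnitAddCircle,
      (η.map rep).map (fun t : ℝ => (t : UnitAddCircle)) = η := by
    intro η
    rw [Measure.map_map AddCircle.measurable_mk' measurable_rep]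
    have : ((fun t : ℝ => (t : UnitAddCircle)) ∘ rep) = id := by
      funext z; exact coe_rep z
    rw [this, Measure.map_id]
  rw [← hback μ, ← hback ν, erep]

theorem uniquely_ergodic
    (T : UnitAddCircle → UnitAddCircle) (hT : Continuous T)
    (hfib : ∀ y : UnitAddCircle, (T ⁻¹' {y}).Finite)
    (X : Set UnitAddCircle) (hrot : IsRotational T X)
    (hinf : X.Infinite) (hproper : X ≠ Set.univ) :
    ∃! μ : Measure UnitAddCircle,
      IsProbabilityMeasure μ ∧ μ Xᶜ = 0 ∧
        ∀ s : Set UnitAddCircle, MeasurableSet s → μ (T ⁻¹' s) = μ s := by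
  obtain ⟨μ, hμ⟩ := exists_inv T hT X hrot.1 hrot.2.1 hinf.nonempty
  exact ⟨μ, hμ, fun ν hν => invMeas_unique hT hrot hinf hν hμ⟩
end

section
/- Let T: 𝕋 → 𝕋 be continuous with finite fibers and X ⊂ 𝕋 an infinite rotational proper subset. Then (X, T|_X) is a topological extension of an irrational rotation of the circle: there exists an irrational θ₀ and a continuous surjection φ: X → 𝕋 with φ ∘ T = R_{θ₀} ∘ φ, where R_{θ₀} is rotation by θ₀; moreover φ is injective except over at most countably many points of 𝕋, over which the fiber has cardinality exactly two. -/
open Set Filter MeasureTheory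

theorem exists_inv_measure {E : Type*} [MetricSpace E] [CompactSpace E] [MeasurableSpace E]
    [BorelSpace E] (S : E → E) (hS : Continuous S) (x₀ : E) :
    ∃ μ : Measure E, IsProbabilityMeasure μ ∧ MeasurePreserving S μ μ := by
  classical
  let u : ℕ → Measure E := fun n =>
    ((n + 1 : ℕ) : ENNReal)⁻¹ • ∑ k ∈ Finset.range (n+1), Measure.dirac (S^[k] x₀)
  have hu : ∀ n, IsProbabilityMeasure (u n) := by
    intro n
    constructor
    simp only [u, Measure.smul_apply, Measure.finsetSum_apply, measure_univ, smul_eq_mul,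
      Finset.sum_const, Finset.card_range, nsmul_eq_mul, mul_one]
    exact ENNReal.inv_mul_cancel (by simp) (by simp)
  let U : ℕ → ProbabilityMeasure E := fun n => ⟨u n, hu n⟩
  obtain ⟨μ, hμ⟩ : ∃ μ, Tendsto U (hyperfilter ℕ : Filter ℕ) (nhds μ) := by
    obtain ⟨μ, -, h⟩ := isCompact_univ.ultrafilter_le_nhds ((hyperfilter ℕ).map U) (by simp)
    exact ⟨μ, h⟩
  have hint : ∀ (f : BoundedContinuousFunction E ℝ) n, ∫ x, f x ∂(u n) =
      ((n:ℝ)+1)⁻¹ * ∑ k ∈ Finset.range (n+1), f (S^[k] x₀) := by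
    intro f n
    simp only [u]
    rw [integral_smul_measure, integral_finsetSum_measure]
    · simp [ENNReal.toReal_inv, ENNReal.toReal_add]
    · intro i _
      exact f.integrable _
  refine ⟨μ, inferInstance, hS.measurable, ?_⟩
  have : IsProbabilityMeasure (Measure.map S (μ : Measure E)) :=
    Measure.isProbabilityMeasure_map hS.measurable.aemeasurable
  apply ext_of_forall_integral_eq_of_IsFiniteMeasure
  intro f
  rw [integral_map hS.measurable.aemeasurable f.continuous.aestronglyMeasurable]
  let g : BoundedContinuousFunction E ℝ := f.compContinuous ⟨S, hS⟩
  rw [ProbabilityMeasure.tendsto_iff_forall_integral_tendsto] at hμ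
  have h1 := hμ g
  have h2 := hμ f
  have h3 := h1.sub h2
  have h4 : Tendsto (fun n : ℕ => (∫ x, g x ∂(U n : Measure E)) - ∫ x, f x ∂(U n : Measure E)) atTop (nhds 0) := by
    have e : ∀ n : ℕ, (∫ x, g x ∂(U n : Measure E)) - ∫ x, f x ∂(U n : Measure E) =
        ((n:ℝ)+1)⁻¹ * (f (S^[n+1] x₀) - f x₀) := by
      intro n
      change (∫ x, g x ∂(u n)) - ∫ x, f x ∂(u n) = _
      rw [hint, hint, ← mul_sub, ← Finset.sum_sub_distrib]
      congr 1
      have := Finset.sum_range_sub (fun k => f (S^[k] x₀)) (n+1)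
      simp only [Function.iterate_zero, id] at this
      rw [← this]
      refine Finset.sum_congr rfl fun k _ => ?_
      simp [g, Function.iterate_succ_apply']
    simp_rw [e]
    apply squeeze_zero_norm (a := fun n : ℕ => ((n:ℝ)+1)⁻¹ * (‖f‖ + ‖f‖))
    · intro n
      rw [norm_mul, Real.norm_of_nonneg (by positivity)]
      gcongr
      exact (norm_sub_le _ _).trans (add_le_add (f.norm_coe_le_norm _) (f.norm_coe_le_norm _))
    · have := tendsto_one_div_add_atTop_nhds_zero_nat (𝕜 := ℝ)
      simpa using this.mul_const (‖f‖ + ‖f‖)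
  have h5 := h4.mono_left Nat.hyperfilter_le_atTop
  have := tendsto_nhds_unique h3 h5
  have : (∫ x, g x ∂(μ : Measure E)) = ∫ x, f x ∂(μ : Measure E) := by linarith
  exact this

def Cyc (p q s : ℝ) : Prop := (p < q ∧ q < s) ∨ (q < s ∧ s < p) ∨ (s < p ∧ p < q)

theorem toIco_aux (a x y : ℝ) (hx : x ∈ Ico a (a+1)) (hy : y ∈ Ico a (a+1)) :
    toIcoMod one_pos x y = if x ≤ y then y else y + 1 := by
  rw [toIcoMod_eq_iff]
  obtain ⟨h1, h2⟩ := hx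
  obtain ⟨h3, h4⟩ := hy
  split_ifs with h
  · exact ⟨⟨h, by linarith⟩, 0, by simp⟩
  · exact ⟨⟨by linarith, by linarith⟩, -1, by simp⟩

theorem toIoc_aux (a x y : ℝ) (hx : x ∈ Ico a (a+1)) (hy : y ∈ Ico a (a+1)) :
    toIocMod one_pos x y = if x < y then y else y + 1 := by
  rw [toIocMod_eq_iff]
  obtain ⟨h1, h2⟩ := hx
  obtain ⟨h3, h4⟩ := hy
  split_ifs with h
  · exact ⟨⟨h, by linarith⟩, 0, by simp⟩
  · exact ⟨⟨by linarith, by linarith⟩, -1, by simp⟩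

theorem btw_aux (a x y z : ℝ) (hx : x ∈ Ico a (a+1)) (hy : y ∈ Ico a (a+1))
    (hz : z ∈ Ico a (a+1)) :
    btw (x : UnitAddCircle) (y : UnitAddCircle) (z : UnitAddCircle) ↔ ¬ Cyc z y x := by
  have h := @QuotientAddGroup.btw_coe_iff ℝ _ _ _ _ 1 ⟨one_pos⟩ x y z
  refine h.trans ?_
  rw [toIco_aux a x y hx hy, toIoc_aux a x z hx hz]
  obtain ⟨h1, h2⟩ := hx
  obtain ⟨h3, h4⟩ := hy
  obtain ⟨h5, h6⟩ := hz
  unfold Cyc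
  split_ifs <;> grind

theorem sbtw_aux (a x y z : ℝ) (hx : x ∈ Ico a (a+1)) (hy : y ∈ Ico a (a+1))
    (hz : z ∈ Ico a (a+1)) :
    sbtw (x : UnitAddCircle) (y : UnitAddCircle) (z : UnitAddCircle) ↔ Cyc x y z := by
  rw [sbtw_iff_not_btw, btw_aux a z y x hz hy hx, not_not]

section core
set_option linter.unusedSectionVars false
variable {E : Type*} [MetricSpace E] [CompactSpace E] [MeasurableSpace E] [BorelSpace E]

theorem periodic_finite (S : E → E)
    (hmin : ∀ x y : E, y ∈ closure {z : E | ∃ n : ℕ, S^[n] x = z}) (x : E)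
    (h : {z : E | ∃ n : ℕ, S^[n] x = z}.Finite) : Finite E := by
  rw [← Set.finite_univ_iff]
  refine h.subset fun y _ => ?_
  have := hmin x y
  rwa [h.isClosed.closure_eq] at this

theorem no_periodic (S : E → E)
    (hmin : ∀ x y : E, y ∈ closure {z : E | ∃ n : ℕ, S^[n] x = z})
    [Infinite E] (y : E) (m : ℕ) (hm : m ≠ 0) (hper : S^[m] y = y) : False := by
  classical
  refine not_finite_iff_infinite.2 ‹Infinite E› (periodic_finite S hmin y ?_)
  refine ((Finset.range m).image fun k => S^[k] y).finite_toSet.subset ?_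
  rintro z ⟨n, rfl⟩
  simp only [Finset.coe_image, Finset.coe_range, mem_image, mem_Iio]
  exact ⟨n % m, Nat.mod_lt _ (Nat.pos_of_ne_zero hm),
    Function.IsPeriodicPt.iterate_mod_apply hper n⟩

theorem noatom (S : E → E) (hmin : ∀ x y : E, y ∈ closure {z : E | ∃ n : ℕ, S^[n] x = z})
    [Infinite E] (μ : Measure E) [IsProbabilityMeasure μ] (hμ : MeasurePreserving S μ μ) (x : E) :
    μ {x} = 0 := by
  by_contra hne
  obtain ⟨y, hy, m, hm, hmy⟩ := hμ.exists_mem_iterate_mem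
    (measurableSet_singleton x).nullMeasurableSet hne
  obtain rfl : y = x := hy
  exact no_periodic S hmin y m hm hmy

theorem fullsupp (S : E → E) (hmin : ∀ x y : E, y ∈ closure {z : E | ∃ n : ℕ, S^[n] x = z})
    (μ : Measure E) [IsProbabilityMeasure μ] (hμ : MeasurePreserving S μ μ)
    (U : Set E) (hU : IsOpen U) (x : E) (hx : x ∈ U) : μ U ≠ 0 := by
  intro h0
  have : (univ : Set E) ⊆ ⋃ n : ℕ, S^[n] ⁻¹' U := by
    intro y _
    obtain ⟨z, hz, n, rfl⟩ := mem_closure_iff.1 (hmin y x) U hU hx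
    exact mem_iUnion.2 ⟨n, hz⟩
  have h1 : μ (⋃ n : ℕ, S^[n] ⁻¹' U) = 0 := by
    rw [measure_iUnion_null_iff]
    intro n
    rw [(hμ.iterate n).measure_preimage hU.measurableSet.nullMeasurableSet, h0]
  have := measure_mono_null this h1
  simp at this

theorem cdf_cont (ν : Measure ℝ) [IsProbabilityMeasure ν] (h : ∀ t, ν {t} = 0) :
    Continuous (ProbabilityTheory.cdf ν) := by
  rw [continuous_iff_continuousAt]
  intro t
  rw [(ProbabilityTheory.cdf ν).mono.continuousAt_iff_leftLim_eq_rightLim,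
    StieltjesFunction.rightLim_eq]
  have h1 := (ProbabilityTheory.cdf ν).measure_singleton t
  rw [ProbabilityTheory.measure_cdf, h t, eq_comm, ENNReal.ofReal_eq_zero] at h1
  have := (ProbabilityTheory.cdf ν).mono.leftLim_le (le_refl t)
  linarith

theorem arc_lt (ν : Measure ℝ) [IsProbabilityMeasure ν] (h : ∀ t, ν {t} = 0) {s t : ℝ}
    (hst : s ≤ t) : ν.real (Ioo s t) = ProbabilityTheory.cdf ν t - ProbabilityTheory.cdf ν s := by
  have : NullSingletonClass ν := ⟨h⟩
  rw [measureReal_congr Ioo_ae_eq_Ioc, ProbabilityTheory.cdf_eq_real, ProbabilityTheory.cdf_eq_real,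
    ← Iic_union_Ioc_eq_Iic hst, measureReal_union (Iic_disjoint_Ioc le_rfl) measurableSet_Ioc]
  ring

theorem cyc_lt {s t : ℝ} (hst : s < t) : {z | Cyc s z t} = Ioo s t := by
  ext z; simp only [Cyc, mem_ofPred_eq, mem_Ioo]; grind

theorem cyc_gt {s t : ℝ} (hst : t < s) : {z | Cyc s z t} = (Icc t s)ᶜ := by
  ext z; simp only [Cyc, mem_ofPred_eq, mem_compl_iff, mem_Icc]; grind

theorem cyc_meas {s t : ℝ} (hst : s ≠ t) : MeasurableSet {z | Cyc s z t} := by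
  rcases hst.lt_or_gt with h | h
  · rw [cyc_lt h]; exact measurableSet_Ioo
  · rw [cyc_gt h]; exact measurableSet_Icc.compl

theorem cyc_open {s t : ℝ} (hst : s ≠ t) : IsOpen {z | Cyc s z t} := by
  rcases hst.lt_or_gt with h | h
  · rw [cyc_lt h]; exact isOpen_Ioo
  · rw [cyc_gt h]; exact isClosed_Icc.isOpen_compl

/-- measure of a cyclic arc. -/
theorem arc_meas (ν : Measure ℝ) [IsProbabilityMeasure ν] (h : ∀ t, ν {t} = 0) {s t : ℝ}
    (hst : s ≠ t) : ν.real {z | Cyc s z t} =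
      ProbabilityTheory.cdf ν t - ProbabilityTheory.cdf ν s + if s < t then 0 else 1 := by
  rcases hst.lt_or_gt with hl | hl
  · rw [cyc_lt hl, arc_lt ν h hl.le, if_pos hl, add_zero]
  · have : NullSingletonClass ν := ⟨h⟩
    rw [cyc_gt hl, if_neg hl.not_gt, measureReal_compl measurableSet_Icc,
      ← measureReal_congr Ioo_ae_eq_Icc, arc_lt ν h hl.le]
    simp; ring

theorem arc_sum (ν : Measure ℝ) [IsProbabilityMeasure ν] (h : ∀ t, ν {t} = 0) {s t : ℝ}
    (hst : s ≠ t) : ν.real {z | Cyc s z t} + ν.real {z | Cyc t z s} = 1 := by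
  rw [arc_meas ν h hst, arc_meas ν h hst.symm]
  rcases hst.lt_or_gt with hl | hl
  · simp only [hl, hl.not_gt, if_true, if_false]; ring
  · simp only [hl, hl.not_gt, if_true, if_false]; ring

/-- key equivariance -/
theorem equivar (S : E → E) (hS : Continuous S)
    (hfib : ∀ y, (S ⁻¹' {y}).Finite) (r : E → ℝ) (hr : Continuous r)
    (hinj : Function.Injective r)
    (hcyc : ∀ p q s, S p ≠ S q → S q ≠ S s → S s ≠ S p → Cyc (r p) (r q) (r s) →
      Cyc (r (S p)) (r (S q)) (r (S s)))
    (μ : Measure E) [IsProbabilityMeasure μ] (hμ : MeasurePreserving S μ μ)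
    (hat : ∀ x, μ {x} = 0)
    (ν : Measure ℝ) [IsProbabilityMeasure ν] (hν : ν = μ.map r) (hνat : ∀ t, ν {t} = 0)
    (x y : E) : ∃ n : ℤ, ProbabilityTheory.cdf ν (r (S y)) - ProbabilityTheory.cdf ν (r (S x)) =
      ProbabilityTheory.cdf ν (r y) - ProbabilityTheory.cdf ν (r x) + n := by
  have hpre : ∀ A : Set ℝ, MeasurableSet A → ν.real A = μ.real (r ⁻¹' A) := by
    intro A hA
    rw [hν, map_measureReal_apply hr.measurable hA]
  by_cases hxy : x = y
  · subst hxy; exact ⟨0, by simp⟩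
  have hrxy : r x ≠ r y := fun h => hxy (hinj h)
  by_cases hSxy : S x = S y
  · -- one of the arcs is null
    rw [hSxy, sub_self]
    have key : ν.real {z | Cyc (r x) z (r y)} = 0 ∨ ν.real {z | Cyc (r y) z (r x)} = 0 := by
      by_contra! hcon
      obtain ⟨h1, h2⟩ := hcon
      have hbig : ∀ a b : ℝ, a ≠ b → ν.real {z | Cyc a z b} ≠ 0 → ∀ F : Set E, F.Finite →
          ∃ z, Cyc a (r z) b ∧ z ∉ F := by
        intro a b hab hne F hF
        by_contra! hc
        apply hne
        rw [hpre _ (cyc_meas hab)]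
        have : μ F = 0 := by
          have : NullSingletonClass μ := ⟨hat⟩
          exact hF.measure_zero μ
        have h0 : μ (r ⁻¹' {z | Cyc a z b}) = 0 := measure_mono_null (t := F) hc this
        rw [measureReal_def, h0]
        rfl
      obtain ⟨z, hz, hzF⟩ := hbig _ _ hrxy h1 _ (hfib (S x))
      obtain ⟨w, hw, hwF⟩ := hbig _ _ hrxy.symm h2 _ ((hfib (S x)).union (hfib (S z)))
      simp only [mem_union, mem_preimage, mem_singleton_iff, not_or] at hzF hwF
      have c1 := hcyc x z w (Ne.symm hzF) (Ne.symm hwF.2) hwF.1 (by unfold Cyc at *; grind)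
      have c2 := hcyc z y w (by rwa [← hSxy]) (by rw [← hSxy]; exact Ne.symm hwF.1) hwF.2
        (by unfold Cyc at *; grind)
      rw [← hSxy] at c2
      unfold Cyc at c1 c2
      grind
    have a1 := arc_meas ν hνat hrxy
    have a2 := arc_meas ν hνat hrxy.symm
    rcases hrxy.lt_or_gt with hl | hl
    · rw [if_pos hl] at a1
      rw [if_neg hl.not_gt] at a2
      rcases key with k | k
      · exact ⟨0, by push_cast; linarith⟩
      · exact ⟨-1, by push_cast; linarith⟩
    · rw [if_neg hl.not_gt] at a1
      rw [if_pos hl] at a2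
      rcases key with k | k
      · exact ⟨1, by push_cast; linarith⟩
      · exact ⟨0, by push_cast; linarith⟩
  · have hle : ∀ x y : E, S x ≠ S y → ν.real {z | Cyc (r (S x)) z (r (S y))} ≤
        ν.real {z | Cyc (r x) z (r y)} := by
      intro x y hSxy
      have hne : r x ≠ r y := fun h => hSxy (by rw [hinj h])
      have hne' : r (S x) ≠ r (S y) := fun h => hSxy (hinj h)
      rw [hpre _ (cyc_meas hne), hpre _ (cyc_meas hne'),
        ← hμ.measureReal_preimage (hr.measurable (cyc_meas hne')).nullMeasurableSet]
      refine measureReal_mono ?_ (measure_ne_top _ _)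
      intro z hz
      have hz : Cyc (r (S x)) (r (S z)) (r (S y)) := hz
      show Cyc (r x) (r z) (r y)
      have n1 : S x ≠ S z := by intro h; rw [h] at hz; unfold Cyc at hz; grind
      have n2 : S z ≠ S y := by intro h; rw [h] at hz; unfold Cyc at hz; grind
      have m1 : r x ≠ r z := fun h => n1 (by rw [hinj h])
      have m2 : r z ≠ r y := fun h => n2 (by rw [hinj h])
      by_contra hc
      have := hcyc x y z hSxy n2.symm n1.symm (by unfold Cyc at *; grind)
      unfold Cyc at this hz; grind
    have l1 := hle x y hSxy
    have l2 := hle y x (Ne.symm hSxy)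
    have hne' : r (S x) ≠ r (S y) := fun h => hSxy (hinj h)
    have s1 := arc_sum ν hνat hrxy
    have s2 := arc_sum ν hνat hne'
    have e : ν.real {z | Cyc (r (S x)) z (r (S y))} = ν.real {z | Cyc (r x) z (r y)} := by linarith
    rw [arc_meas ν hνat hrxy, arc_meas ν hνat hne'] at e
    refine ⟨(if r x < r y then 0 else 1) - (if r (S x) < r (S y) then 0 else 1), ?_⟩
    push_cast
    split_ifs at e ⊢ <;> push_cast <;> linarith

theorem core_thm (S : E → E) (hS : Continuous S)
    (hfib : ∀ y, (S ⁻¹' {y}).Finite) (r : E → ℝ) (hr : Continuous r)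
    (hinj : Function.Injective r) [Infinite E]
    (hmin : ∀ x y : E, y ∈ closure {z : E | ∃ n : ℕ, S^[n] x = z})
    (hcyc : ∀ p q s, S p ≠ S q → S q ≠ S s → S s ≠ S p → Cyc (r p) (r q) (r s) →
      Cyc (r (S p)) (r (S q)) (r (S s))) :
    ∃ θ₀ : ℝ, Irrational θ₀ ∧ ∃ φ : E → UnitAddCircle, Continuous φ ∧ Function.Surjective φ ∧
      (∀ x, φ (S x) = φ x + ((θ₀ : ℝ) : UnitAddCircle)) ∧
      ∃ C : Set UnitAddCircle, C.Countable ∧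
        (∀ y : UnitAddCircle, y ∉ C → ∃ x, {x | φ x = y} = {x}) ∧
        (∀ y ∈ C, ∃ x x', x ≠ x' ∧ {x | φ x = y} = {x, x'}) := by
  obtain ⟨x₀⟩ : Nonempty E := inferInstance
  obtain ⟨μ, hμp, hμ⟩ := exists_inv_measure S hS x₀
  have hat := noatom S hmin μ hμ
  have hsupp := fullsupp S hmin μ hμ
  obtain ⟨ν, hν⟩ : ∃ ν : Measure ℝ, ν = μ.map r := ⟨_, rfl⟩
  have hνp : IsProbabilityMeasure ν := by
    rw [hν]; exact Measure.isProbabilityMeasure_map hr.measurable.aemeasurable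
  have hpre : ∀ A : Set ℝ, MeasurableSet A → ν A = μ (r ⁻¹' A) := by
    intro A hA
    rw [hν, Measure.map_apply hr.measurable hA]
  have hνat : ∀ t, ν {t} = 0 := by
    intro t
    rw [hpre _ (measurableSet_singleton t)]
    have : NullSingletonClass μ := ⟨hat⟩
    exact (Set.Subsingleton.preimage subsingleton_singleton hinj).measure_zero μ
  have hopen : ∀ (A : Set ℝ), IsOpen A → ∀ x, r x ∈ A → 0 < ν.real A := by
    intro A hA x hx
    rw [measureReal_def]
    refine ENNReal.toReal_pos ?_ (measure_ne_top _ _)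
    rw [hpre _ hA.measurableSet]
    exact hsupp _ (hA.preimage hr) x hx
  obtain ⟨G, hG⟩ : ∃ G : ℝ → ℝ, G = ProbabilityTheory.cdf ν := ⟨_, rfl⟩
  have hGc : Continuous G := by rw [hG]; exact cdf_cont ν hνat
  have hGm : Monotone G := by rw [hG]; exact ProbabilityTheory.monotone_cdf ν
  have hG0 : ∀ t, 0 ≤ G t := by rw [hG]; exact ProbabilityTheory.cdf_nonneg ν
  have hG1 : ∀ t, G t ≤ 1 := by rw [hG]; exact ProbabilityTheory.cdf_le_one ν
  have hGr : ∀ t, G t = ν.real (Iic t) := by rw [hG]; exact ProbabilityTheory.cdf_eq_real ν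
  have hIoo : ∀ s t, s ≤ t → ν.real (Ioo s t) = G t - G s := by
    rw [hG]; intro s t h; exact arc_lt ν hνat h
  have hgap : ∀ x y z, r x < r y → r y < r z → G (r x) < G (r z) := by
    intro x y z h1 h2
    have := hopen (Ioo (r x) (r z)) isOpen_Ioo y ⟨h1, h2⟩
    rw [hIoo _ _ (h1.trans h2).le] at this
    linarith
  have hpos : ∀ x y, r x < r y → 0 < G (r y) := by
    intro x y h
    have h1 := hopen (Iio (r y)) isOpen_Iio x h
    have h2 := measureReal_mono (μ := ν) (Iio_subset_Iic_self (a := r y)) (measure_ne_top _ _)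
    rw [hGr]; linarith
  have hlt1 : ∀ x y, r x < r y → G (r x) < 1 := by
    intro x y h
    have h1 := hopen (Ioi (r x)) isOpen_Ioi y h
    have h2 := measureReal_compl (μ := ν) (measurableSet_Iic (a := r x))
    rw [compl_Iic, probReal_univ] at h2
    rw [hGr]; linarith
  obtain ⟨φ, hφ⟩ : ∃ φ : E → UnitAddCircle, φ = fun x => ((G (r x) : ℝ) : UnitAddCircle) := ⟨_, rfl⟩
  have hφx : ∀ x, φ x = ((G (r x) : ℝ) : UnitAddCircle) := fun x => by rw [hφ]
  have hcoe : ∀ s t : ℝ, (s : UnitAddCircle) = (t : UnitAddCircle) ↔ ∃ n : ℤ, s = t + n := by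
    intro s t
    rw [← sub_eq_zero, ← AddCircle.coe_sub, AddCircle.coe_eq_zero_iff]
    simp only [zsmul_eq_mul, mul_one]
    exact ⟨fun ⟨n, h⟩ => ⟨n, by linarith⟩, fun ⟨n, h⟩ => ⟨n, by linarith⟩⟩
  -- φ agrees: either G equal or {0,1}
  have hdich : ∀ x y, φ x = φ y → G (r x) = G (r y) ∨ (G (r x) = 0 ∧ G (r y) = 1) ∨
      (G (r x) = 1 ∧ G (r y) = 0) := by
    intro x y h
    rw [hφx, hφx, hcoe] at h
    obtain ⟨n, hn⟩ := h
    have a1 := hG0 (r x)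
    have a2 := hG0 (r y)
    have a3 := hG1 (r x)
    have a4 := hG1 (r y)
    have b1 : (-2 : ℝ) < n := by linarith
    have b2 : (n : ℝ) < 2 := by linarith
    have c1 : -2 < n := by exact_mod_cast b1
    have c2 : n < 2 := by exact_mod_cast b2
    obtain rfl | rfl | rfl : n = -1 ∨ n = 0 ∨ n = 1 := by omega
    · right; left; push_cast at hn; constructor <;> linarith
    · left; push_cast at hn; linarith
    · right; right; push_cast at hn; constructor <;> linarith
  have hsort : ∀ x y z, r x < r y → r y < r z → φ x = φ y → φ y = φ z → False := by
    intro x y z h1 h2 e1 e2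
    have g := hgap x y z h1 h2
    have p := hpos x y h1
    have q := hlt1 y z h2
    rcases hdich x y e1 with h | h | h <;> rcases hdich y z e2 with h' | h' | h' <;> grind
  have hthree : ∀ x y z, φ x = φ y → φ y = φ z → x = y ∨ y = z ∨ x = z := by
    intro x y z e1 e2
    by_contra! hc
    obtain ⟨n1, n2, n3⟩ := hc
    have n1 := hinj.ne n1
    have n2 := hinj.ne n2
    have n3 := hinj.ne n3
    have e3 := e1.trans e2
    rcases n1.lt_or_gt with h1 | h1 <;> rcases n2.lt_or_gt with h2 | h2 <;>
      rcases n3.lt_or_gt with h3 | h3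
    · exact hsort x y z h1 h2 e1 e2
    · exact hsort x y z h1 h2 e1 e2
    · exact hsort x z y h3 h2 e3 e2.symm
    · exact hsort z x y h3 h1 e3.symm e1
    · exact hsort y x z h1 h3 e1.symm e3
    · exact hsort y z x h2 h3 e2 e3.symm
    · exact hsort z y x h2 h1 e2.symm e1.symm
    · exact hsort z y x h2 h1 e2.symm e1.symm
  have hsurj : Function.Surjective φ := by
    intro c
    obtain ⟨t, ht, rfl⟩ : ∃ t ∈ Ico (0:ℝ) 1, (t : UnitAddCircle) = c := by
      have := AddCircle.coe_image_Ico_eq (1:ℝ) 0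
      have h : c ∈ ((↑) : ℝ → UnitAddCircle) '' Ico (0:ℝ) (0+1) := by rw [this]; trivial
      simpa using h
    rcases ht.1.eq_or_lt with h0 | h0
    · obtain ⟨x, hx, hmn⟩ := isCompact_univ.exists_isMinOn (univ_nonempty (α := E)) hr.continuousOn
      refine ⟨x, ?_⟩
      rw [hφx, ← h0]
      congr 1
      rw [hGr, measureReal_def, hpre _ measurableSet_Iic]
      have : r ⁻¹' Iic (r x) ⊆ {x} := by
        intro z hz
        exact hinj (le_antisymm hz (hmn (mem_univ z)))
      rw [measure_mono_null this (hat x)]; rfl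
    · have hlo : ∃ s, G s ≤ t := by
        have := ProbabilityTheory.tendsto_cdf_atBot ν
        rw [← hG] at this
        exact (this.eventually (gt_mem_nhds h0)).exists.imp fun _ h => le_of_lt h
      have hhi : ∃ s, t ≤ G s := by
        have := ProbabilityTheory.tendsto_cdf_atTop ν
        rw [← hG] at this
        exact (this.eventually (lt_mem_nhds ht.2)).exists.imp fun _ h => le_of_lt h
      obtain ⟨s, hs⟩ := mem_range_of_exists_le_of_exists_ge hGc hlo hhi
      have hKc : IsCompact (r ⁻¹' Iic s) := (isClosed_Iic.preimage hr).isCompact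
      have hKn : (r ⁻¹' Iic s).Nonempty := by
        rw [nonempty_iff_ne_empty]
        intro he
        have := hGr s
        rw [measureReal_def, hpre _ measurableSet_Iic, he, measure_empty] at this
        simp at this; linarith
      obtain ⟨x, hx, hmx⟩ := hKc.exists_isMaxOn hKn hr.continuousOn
      refine ⟨x, ?_⟩
      rw [hφx, ← hs]
      congr 1
      have h1 := hIoo (r x) s hx
      have h2 : r ⁻¹' Ioo (r x) s = ∅ := by
        rw [eq_empty_iff_forall_notMem]
        intro z hz
        have : r z ≤ r x := hmx (show z ∈ r ⁻¹' Iic s from hz.2.le)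
        exact absurd hz.1 this.not_gt
      rw [measureReal_def, hpre _ measurableSet_Ioo, h2, measure_empty] at h1
      simp at h1; linarith
  have heq : ∀ x, φ (S x) = φ x + ((G (r (S x₀)) - G (r x₀) : ℝ) : UnitAddCircle) := by
    intro x
    obtain ⟨n, hn⟩ := equivar S hS hfib r hr hinj hcyc μ hμ hat ν hν hνat x₀ x
    rw [← hG] at hn
    rw [hφx, hφx, ← AddCircle.coe_add, hcoe]
    exact ⟨n, by linarith⟩
  obtain ⟨θ, hθ⟩ : ∃ θ : ℝ, θ = G (r (S x₀)) - G (r x₀) := ⟨_, rfl⟩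
  rw [← hθ] at heq
  have hiter : ∀ n : ℕ, ∀ x, φ (S^[n] x) = φ x + ((n * θ : ℝ) : UnitAddCircle) := by
    intro n
    induction n with
    | zero => simp
    | succ n ih =>
      intro x
      rw [Function.iterate_succ_apply', heq, ih, add_assoc, ← AddCircle.coe_add]
      congr 2
      push_cast; ring
  refine ⟨θ, ?_, φ, ?_, hsurj, heq, ?_⟩
  · rintro ⟨q, hq⟩
    have hp : ∀ (k : ℕ) x, φ (S^[k * q.den] x) = φ x := by
      intro k x
      rw [hiter, hφx, ← AddCircle.coe_add, hcoe]
      refine ⟨k * q.num, ?_⟩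
      have : (q.den : ℝ) * q = q.num := by exact_mod_cast Rat.den_mul_eq_num q
      rw [← hq]
      push_cast
      rw [← this]; ring
    have hd := q.den_ne_zero
    have hper : ∀ i j : ℕ, i < j → S^[i] x₀ = S^[j] x₀ → False := by
      intro i j hij h
      refine no_periodic S hmin (S^[i] x₀) (j - i) (by omega) ?_
      rw [← Function.iterate_add_apply, Nat.sub_add_cancel hij.le, h]
    have hpos := Nat.pos_of_ne_zero hd
    rcases hthree (S^[0 * q.den] x₀) (S^[1 * q.den] x₀) (S^[2 * q.den] x₀)
      (by rw [hp, hp]) (by rw [hp, hp]) with h | h | h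
    · exact hper _ _ (by omega) h
    · exact hper _ _ (by omega) h
    · exact hper _ _ (by omega) h
  · rw [hφ]
    exact (AddCircle.continuous_mk' 1).comp (hGc.comp hr)
  · refine ⟨{c | ∃ x y, x ≠ y ∧ φ x = c ∧ φ y = c}, ?_, ?_, ?_⟩
    · have hc := hGm.countable_setOfPred_two_preimages
      refine ((hc.image ((↑) : ℝ → UnitAddCircle)).union (countable_singleton 0)).mono ?_
      rintro c ⟨x, y, hxy, hx, hy⟩
      rcases hdich x y (hx.trans hy.symm) with h | h | h
      · left
        refine ⟨G (r x), ?_, by rw [← hx, hφx]⟩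
        rcases (hinj.ne hxy).lt_or_gt with h' | h'
        · exact ⟨r x, r y, h', rfl, h.symm⟩
        · exact ⟨r y, r x, h', h.symm, rfl⟩
      · right
        rw [mem_singleton_iff, ← hx, hφx, h.1]; simp
      · right
        rw [mem_singleton_iff, ← hy, hφx, h.2]; simp
    · intro c hc
      obtain ⟨x, hx⟩ := hsurj c
      refine ⟨x, ?_⟩
      ext y
      simp only [mem_ofPred_eq, mem_singleton_iff]
      constructor
      · intro hy
        by_contra hne
        exact hc ⟨y, x, hne, hy, hx⟩
      · rintro rfl; exact hx
    · rintro c ⟨x, y, hxy, hx, hy⟩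
      refine ⟨x, y, hxy, ?_⟩
      ext z
      simp only [mem_ofPred_eq, mem_singleton_iff, mem_insert_iff]
      constructor
      · intro hz
        rcases hthree x y z (hx.trans hy.symm) (hy.trans hz.symm) with h | h | h
        · exact absurd h hxy
        · exact Or.inr h.symm
        · exact Or.inl h.symm
      · rintro (rfl | rfl)
        · exact hx
        · exact hy

end core

theorem extension_of_irrational_rotation
    (T : UnitAddCircle → UnitAddCircle) (hT : Continuous T)
    (hfib : ∀ y : UnitAddCircle, (T ⁻¹' {y}).Finite)
    (X : Set UnitAddCircle) (hrot : IsRotational T X)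
    (hinf : X.Infinite) (hproper : X ≠ Set.univ) :
    ∃ θ₀ : ℝ, Irrational θ₀ ∧
      ∃ φ : UnitAddCircle → UnitAddCircle,
        ContinuousOn φ X ∧ φ '' X = Set.univ ∧
        (∀ x ∈ X, φ (T x) = φ x + ((θ₀ : ℝ) : UnitAddCircle)) ∧
        ∃ C : Set UnitAddCircle, C.Countable ∧
          (∀ y : UnitAddCircle, y ∉ C → ({x ∈ X | φ x = y}).ncard = 1) ∧
          (∀ y ∈ C, ({x ∈ X | φ x = y}).ncard = 2) := by
  classical
  obtain ⟨hcl, hmaps, hmin, hord⟩ := hrot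
  obtain ⟨a', ha'⟩ : ∃ a', a' ∉ X := by
    by_contra! h
    exact hproper (eq_univ_of_forall h)
  obtain ⟨a, rfl⟩ := QuotientAddGroup.mk_surjective a'
  have : CompactSpace X := isCompact_iff_compactSpace.1 hcl.isCompact
  have : Infinite X := hinf.to_subtype
  let S : X → X := hmaps.restrict T X X
  have hS : Continuous S := hT.restrict hmaps
  have hSv : ∀ x, (S x : UnitAddCircle) = T x := fun x => rfl
  have hSn : ∀ n x, ((S^[n] x : X) : UnitAddCircle) = T^[n] x := by
    intro n
    induction n with
    | zero => intro x; rfl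
    | succ n ih => intro x; rw [Function.iterate_succ_apply', Function.iterate_succ_apply', hSv, ih]
  let r : X → ℝ := fun x => (AddCircle.equivIco (1:ℝ) a (x : UnitAddCircle) : ℝ)
  have hr : Continuous r := by
    rw [continuous_iff_continuousAt]
    intro x
    have hx : (x : UnitAddCircle) ≠ (a : UnitAddCircle) := fun h => ha' (h ▸ x.2)
    exact continuousAt_subtype_val.comp
      ((AddCircle.continuousAt_equivIco (1:ℝ) a hx).comp continuousAt_subtype_val)
  have hrm : ∀ x, r x ∈ Ico a (a+1) := fun x => (AddCircle.equivIco (1:ℝ) a x).2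
  have hrc : ∀ x, ((r x : ℝ) : UnitAddCircle) = x := fun x =>
    (AddCircle.equivIco (1:ℝ) a).symm_apply_apply (x : UnitAddCircle)
  have hinj : Function.Injective r := by
    intro x y h
    apply Subtype.ext
    rw [← hrc x, ← hrc y, h]
  have hsb : ∀ x y z : X, sbtw (x : UnitAddCircle) y z ↔ Cyc (r x) (r y) (r z) := by
    intro x y z
    rw [← sbtw_aux a _ _ _ (hrm x) (hrm y) (hrm z), hrc, hrc, hrc]
  obtain ⟨θ, hθ, φ, hφc, hφs, hφe, C, hC, hC1, hC2⟩ := core_thm S hS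
    (by
      intro y
      refine Set.Finite.of_finite_image (f := Subtype.val) ((hfib y).subset ?_)
        Subtype.val_injective.injOn
      rintro _ ⟨x, hx, rfl⟩
      have hx : S x = y := hx
      show T x = y
      rw [← hSv, hx])
    r hr hinj
    (by
      intro x y
      rw [closure_subtype]
      refine closure_mono ?_ (hmin x x.2 y y.2)
      rintro z ⟨n, rfl⟩
      exact ⟨S^[n] x, ⟨n, rfl⟩, hSn n x⟩)
    (by
      intro p q s h1 h2 h3 h
      rw [← hsb] at h ⊢
      exact hord p p.2 q q.2 s s.2 (fun h => h1 (Subtype.ext h)) (fun h => h2 (Subtype.ext h))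
        (fun h => h3 (Subtype.ext h)) h)
  let ψ : UnitAddCircle → UnitAddCircle := fun z => if h : z ∈ X then φ ⟨z, h⟩ else 0
  have hψ : ∀ x : X, ψ x = φ x := fun x => by simp [ψ]
  have hfibre : ∀ y, {x ∈ X | ψ x = y} = Subtype.val '' {x : X | φ x = y} := by
    intro y
    ext z
    constructor
    · rintro ⟨hz, h⟩
      exact ⟨⟨z, hz⟩, (hψ ⟨z, hz⟩).symm.trans h, rfl⟩
    · rintro ⟨x, hx, rfl⟩
      exact ⟨x.2, (hψ x).trans hx⟩
  refine ⟨θ, hθ, ψ, ?_, ?_, ?_, C, hC, ?_, ?_⟩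
  · rw [continuousOn_iff_continuous_domRestrict]
    exact hφc.congr fun x => (hψ x).symm
  · rw [eq_univ_iff_forall]
    intro c
    obtain ⟨x, rfl⟩ := hφs c
    exact ⟨x, x.2, hψ x⟩
  · intro x hx
    have := hφe ⟨x, hx⟩
    rw [← hψ, ← hψ] at this
    exact this
  · intro y hy
    obtain ⟨x, hx⟩ := hC1 y hy
    rw [hfibre, hx, image_singleton, ncard_singleton]
  · intro y hy
    obtain ⟨x, x', hne, hx⟩ := hC2 y hy
    rw [hfibre, hx, image_pair, ncard_pair]
    exact fun h => hne (Subtype.ext h)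
end

section
/- Let θ₀ be irrational, τ(ω) = ω + θ₀ mod 1, and fix a partition 0 = t₀ < ⋯ < t_ℓ = 1 with t_m ≡ −θ₀ (mod 1) for some 0 < m < ℓ, intervals J_k = [t_k, t_{k+1}], and digits 0 ≤ k₀ < k₁ < ⋯ < k_{ℓ−1} ≤ d−1. For ω ∈ 𝔇₀ define E(ω) ∈ [0,1) as the real number whose d-adic expansion has n-th digit k_i when ω + nθ₀ mod 1 ∈ J_i. Then E: 𝔇₀ → 𝕋 is continuous, injective, monotone increasing, and satisfies E(τ(ω)) = T(E(ω)) where T(x) = d·x mod 1. -/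
open Set Filter MeasureTheory

lemma cm_fract_eq {a b : ℝ} (h : (a : UnitAddCircle) = (b : UnitAddCircle)) :
    Int.fract a = Int.fract b := by
  rw [← AddCircle.coe_fract a, ← AddCircle.coe_fract b] at h
  refine (AddCircle.coe_eq_coe_iff_of_mem_Ico (p := (1:ℝ)) (a := 0) ?_ ?_).1 h
  · exact ⟨Int.fract_nonneg _, by simpa using Int.fract_lt_one a⟩
  · exact ⟨Int.fract_nonneg _, by simpa using Int.fract_lt_one b⟩

lemma cm_dense {θ : ℝ} (hθ : Irrational θ) (ω u v : ℝ) (hu : 0 ≤ u) (huv : u < v) (hv : v ≤ 1) :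
    ∃ n : ℕ, Int.fract (ω + n * θ) ∈ Set.Ioo u v := by
  have h1 : DenseRange (· • (θ : UnitAddCircle) : ℤ → UnitAddCircle) :=
    AddCircle.denseRange_zsmul_coe_iff.2 (by simpa using hθ)
  have h2 := denseRange_zsmul_iff_nsmul.1 h1
  have ho : IsOpen ((fun x : ℝ => (x : UnitAddCircle)) '' Set.Ioo (u - ω) (v - ω)) :=
    QuotientAddGroup.isOpenMap_coe _ isOpen_Ioo
  have hne : ((fun x : ℝ => (x : UnitAddCircle)) '' Set.Ioo (u - ω) (v - ω)).Nonempty :=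
    (Set.nonempty_Ioo.2 (by linarith)).image _
  obtain ⟨n, z, hz, hzn⟩ := h2.exists_mem_open ho hne
  refine ⟨n, ?_⟩
  have h3 : Int.fract (ω + n * θ) = Int.fract (ω + z) := by
    apply cm_fract_eq
    simp only at hzn
    rw [AddCircle.coe_add, AddCircle.coe_add, hzn, ← nsmul_eq_mul, AddCircle.coe_nsmul]
  have h4 : Int.fract (ω + z) = ω + z :=
    Int.fract_eq_self.2 ⟨by linarith [hz.1], by linarith [hz.2]⟩
  rw [h3, h4]
  exact ⟨by linarith [hz.1], by linarith [hz.2]⟩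

lemma cm_geom {d : ℕ} (hd : 2 ≤ d) :
    HasSum (fun n : ℕ => ((d:ℝ) - 1) / d ^ (n + 1)) 1 := by
  have hd' : (2:ℝ) ≤ d := by exact_mod_cast hd
  have h := (hasSum_geometric_of_lt_one (r := (d:ℝ)⁻¹) (by positivity)
    (inv_lt_one_of_one_lt₀ (by linarith))).mul_left (((d:ℝ) - 1) / d)
  have hd0 : (d:ℝ) ≠ 0 := by positivity
  have hd1 : (d:ℝ) - 1 ≠ 0 := by linarith
  have e1 : (fun n : ℕ => ((d:ℝ) - 1) / d ^ (n + 1)) =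
      fun n : ℕ => ((d:ℝ) - 1) / d * (d:ℝ)⁻¹ ^ n := by
    funext n
    rw [inv_pow, pow_succ', ← div_eq_mul_inv, div_div]
  have e2 : ((d:ℝ) - 1) / d * (1 - (d:ℝ)⁻¹)⁻¹ = 1 := by
    have e3 : 1 - (d:ℝ)⁻¹ = ((d:ℝ) - 1) / d := by
      rw [sub_div, div_self hd0, one_div]
    rw [e3, mul_inv_cancel₀ (div_ne_zero hd1 hd0)]
  rw [e1]
  rw [e2] at h
  exact h

lemma cm_term_le {d : ℕ} (hd : 2 ≤ d) {c : ℕ} (hc : c ≤ d - 1) (n : ℕ) :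
    (c : ℝ) / d ^ (n + 1) ≤ ((d:ℝ) - 1) / d ^ (n + 1) := by
  have : (c:ℝ) + 1 ≤ d := by exact_mod_cast (by omega : c + 1 ≤ d)
  gcongr
  linarith

lemma cm_summable {d : ℕ} (hd : 2 ≤ d) {a : ℕ → ℕ} (ha : ∀ n, a n ≤ d - 1) :
    Summable (fun n => (a n : ℝ) / d ^ (n + 1)) :=
  Summable.of_nonneg_of_le (fun n => by positivity) (fun n => cm_term_le hd (ha n) n)
    (cm_geom hd).summable

lemma cm_le_one {d : ℕ} (hd : 2 ≤ d) {a : ℕ → ℕ} (ha : ∀ n, a n ≤ d - 1) :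
    ∑' n, (a n : ℝ) / d ^ (n + 1) ≤ 1 := by
  rw [← (cm_geom hd).tsum_eq]
  exact (cm_summable hd ha).tsum_le_tsum (fun n => cm_term_le hd (ha n) n) (cm_geom hd).summable

lemma cm_shift {d : ℕ} (hd : 2 ≤ d) {a : ℕ → ℕ} (ha : ∀ n, a n ≤ d - 1) :
    (d:ℝ) * ∑' n, (a n : ℝ) / d ^ (n + 1) = a 0 + ∑' n, (a (n + 1) : ℝ) / d ^ (n + 1) := by
  have hd' : (d:ℝ) ≠ 0 := by positivity
  rw [(cm_summable hd ha).tsum_eq_zero_add, mul_add, ← tsum_mul_left]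
  congr 1
  · rw [zero_add, pow_one, mul_div_cancel₀ _ hd']
  · congr 1
    funext n
    rw [pow_succ' (d:ℝ) (n + 1), ← mul_div_assoc, mul_div_mul_left _ _ hd']

lemma cm_lt {d : ℕ} (hd : 2 ≤ d) (N : ℕ) : ∀ {a b : ℕ → ℕ} (_ : ∀ n, a n ≤ d - 1)
    (_ : ∀ n, b n ≤ d - 1) (_ : ∀ n < N, a n = b n) (_ : a N < b N) (_ : ∃ n > N, 0 < b n),
    ∑' n, (a n : ℝ) / d ^ (n + 1) < ∑' n, (b n : ℝ) / d ^ (n + 1) := by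
  have hd' : (0:ℝ) < d := by positivity
  induction N with
  | zero =>
    intro a b ha hb _ h ⟨n, hn, hbn⟩
    rw [← mul_lt_mul_iff_right₀ hd', cm_shift hd ha, cm_shift hd hb]
    have h1 := cm_le_one hd (a := fun n => a (n + 1)) (fun n => ha _)
    have h2 : 0 < ∑' n, (b (n + 1) : ℝ) / d ^ (n + 1) := by
      obtain ⟨j, rfl⟩ : ∃ j, n = j + 1 := ⟨n - 1, by omega⟩
      exact (cm_summable hd (a := fun n => b (n + 1)) (fun n => hb _)).tsum_pos
        (fun n => by positivity) j (by positivity)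
    have h3 : (a 0 : ℝ) + 1 ≤ b 0 := by exact_mod_cast h
    linarith
  | succ N ih =>
    intro a b ha hb hab h ⟨n, hn, hbn⟩
    rw [← mul_lt_mul_iff_right₀ hd', cm_shift hd ha, cm_shift hd hb, hab 0 (by omega)]
    have := ih (a := fun n => a (n + 1)) (b := fun n => b (n + 1)) (fun n => ha _) (fun n => hb _)
      (fun n hn => hab _ (by omega)) h ⟨n - 1, by omega, by
        have : n - 1 + 1 = n := by omega
        simpa [this] using hbn⟩
    linarith

lemma cm_step {θ φ : ℝ} (h0 : 0 < φ) (h1 : φ < 1)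
    (h : (φ : UnitAddCircle) = ((-θ : ℝ) : UnitAddCircle)) (ω : ℝ) (n : ℕ) :
    Int.fract (ω + (n + 1 : ℕ) * θ) = Int.fract (ω + n * θ) - φ +
      (if Int.fract (ω + n * θ) < φ then 1 else 0) := by
  set x := Int.fract (ω + n * θ) with hx
  have hx0 : 0 ≤ x := Int.fract_nonneg _
  have hx1 : x < 1 := Int.fract_lt_one _
  have e : Int.fract (ω + (n + 1 : ℕ) * θ) = Int.fract (x - φ) := by
    apply cm_fract_eq
    rw [AddCircle.coe_sub, h, hx, AddCircle.coe_fract, ← AddCircle.coe_sub]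
    congr 1
    push_cast
    ring
  rw [e]
  split_ifs with hlt
  · rw [← Int.fract_add_one, Int.fract_eq_self]
    constructor <;> linarith
  · rw [add_zero, Int.fract_eq_self]
    constructor <;> linarith

theorem coding_map_properties
    (d : ℕ) (hd : 2 ≤ d)
    (θ₀ : ℝ) (hθ : Irrational θ₀)
    (ℓ : ℕ) (hℓ : 0 < ℓ) (hℓd : ℓ ≤ d)
    (t : Fin (ℓ + 1) → ℝ) (hmono : StrictMono t)
    (ht0 : t 0 = 0) (ht1 : t (Fin.last ℓ) = 1)
    (m : Fin (ℓ + 1)) (hm0 : 0 < (m : ℕ)) (hmℓ : (m : ℕ) < ℓ)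
    (hmθ : ((t m : ℝ) : UnitAddCircle) = ((-θ₀ : ℝ) : UnitAddCircle))
    (k : Fin ℓ → ℕ) (hk : StrictMono k) (hkd : ∀ i : Fin ℓ, k i ≤ d - 1)
    (D : Set ℝ)
    (hD : D = {ω ∈ Set.Icc (0:ℝ) 1 | ∀ n : ℕ, ∀ i : Fin (ℓ + 1),
        ((ω + n * θ₀ : ℝ) : UnitAddCircle) ≠ ((t i : ℝ) : UnitAddCircle)})
    (dig : ℝ → ℕ → ℕ)
    (hdig : ∀ ω ∈ D, ∀ n : ℕ, ∀ i : Fin ℓ,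
        Int.fract (ω + n * θ₀) ∈ Set.Ioo (t i.castSucc) (t i.succ) → dig ω n = k i)
    (E : ℝ → ℝ)
    (hE : ∀ ω : ℝ, E ω = ∑' n : ℕ, (dig ω n : ℝ) / d ^ (n + 1)) :
    ContinuousOn E D ∧ Set.InjOn E D ∧ StrictMonoOn E D ∧
      ∀ ω ∈ D, ((E (Int.fract (ω + θ₀)) : ℝ) : UnitAddCircle)
        = d • ((E ω : ℝ) : UnitAddCircle) := by
  have hm0' : 0 < t m := by
    rw [← ht0]; exact hmono (by rw [Fin.lt_def]; simpa using hm0)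
  have hm1' : t m < 1 := by
    rw [← ht1]; exact hmono (by rw [Fin.lt_def]; simpa using hmℓ)
  have hstep := cm_step hm0' hm1' hmθ
  have hDI : ∀ ω ∈ D, ω ∈ Set.Ioo (0:ℝ) 1 := by
    intro ω hω
    rw [hD] at hω
    have a := hω.2 0 0
    have b := hω.2 0 (Fin.last ℓ)
    rw [ht0] at a
    rw [ht1] at b
    refine ⟨lt_of_le_of_ne hω.1.1 ?_, lt_of_le_of_ne hω.1.2 ?_⟩
    · rintro rfl; simp at a
    · rintro rfl; simp at b
  have hne : ∀ ω ∈ D, ∀ n : ℕ, ∀ i, Int.fract (ω + n * θ₀) ≠ t i := by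
    intro ω hω n i h
    rw [hD] at hω
    apply hω.2 n i
    rw [← h, AddCircle.coe_fract]
  have hloc : ∀ ω ∈ D, ∀ n : ℕ, ∃ i : Fin ℓ,
      Int.fract (ω + n * θ₀) ∈ Set.Ioo (t i.castSucc) (t i.succ) := by
    intro ω hω n
    by_contra hcon
    push Not at hcon
    have : ∀ i : Fin (ℓ + 1), t i < Int.fract (ω + n * θ₀) := by
      intro i
      induction i using Fin.induction with
      | zero =>
        refine lt_of_le_of_ne ?_ (hne ω hω n 0).symm
        rw [ht0]; exact Int.fract_nonneg _
      | succ i ih =>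
        by_contra h
        exact hcon i ⟨ih, lt_of_le_of_ne (not_lt.1 h) (hne ω hω n _)⟩
    have h1 := this (Fin.last ℓ)
    rw [ht1] at h1
    linarith [Int.fract_lt_one (ω + n * θ₀)]
  have hdigle : ∀ ω ∈ D, ∀ n, dig ω n ≤ d - 1 := by
    intro ω hω n
    obtain ⟨i, hi⟩ := hloc ω hω n
    rw [hdig ω hω n i hi]
    exact hkd i
  have hside : ∀ (i : Fin ℓ) (x y : ℝ), x ∈ Set.Ioo (t i.castSucc) (t i.succ) →
      y ∈ Set.Ioo (t i.castSucc) (t i.succ) → (x < t m ↔ y < t m) := by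
    intro i x y hx hy
    rcases le_or_gt m i.castSucc with h | h
    · have := hmono.monotone h
      constructor <;> intro h' <;> linarith [hx.1, hy.1]
    · have := hmono.monotone (Fin.castSucc_lt_iff_succ_le.1 h)
      constructor <;> intro h' <;> linarith [hx.2, hy.2]
  have hpos : ∀ ω ∈ D, ∀ N : ℕ, ∃ n > N, 0 < dig ω n := by
    intro ω hω N
    by_contra hcon
    push Not at hcon
    have hz : ∀ n > N, Int.fract (ω + n * θ₀) < t m := by
      intro n hn
      obtain ⟨i, hi⟩ := hloc ω hω n
      have h1 := hdig ω hω n i hi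
      have h2 := hcon n hn
      have hi0 : (i : ℕ) = 0 := by
        by_contra h
        have : k ⟨0, hℓ⟩ < k i := hk (by rw [Fin.lt_def]; simp; omega)
        omega
      have : i.succ ≤ m := by rw [Fin.le_def]; simp; omega
      exact lt_of_lt_of_le hi.2 (hmono.monotone this)
    have hlin : ∀ j : ℕ, Int.fract (ω + (N + 1 + j : ℕ) * θ₀) =
        Int.fract (ω + (N + 1 : ℕ) * θ₀) + j * (1 - t m) := by
      intro j
      induction j with
      | zero => simp
      | succ j ih =>
        have := hstep ω (N + 1 + j)
        rw [if_pos (hz _ (by omega)), ih] at this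
        rw [show N + 1 + (j + 1) = N + 1 + j + 1 by ring, this]
        push_cast
        ring
    obtain ⟨j, hj⟩ := exists_nat_gt (1 / (1 - t m))
    rw [div_lt_iff₀ (by linarith)] at hj
    have h1 := hlin j
    have h2 := Int.fract_lt_one (ω + (N + 1 + j : ℕ) * θ₀)
    have h3 := Int.fract_nonneg (ω + (N + 1 : ℕ) * θ₀)
    linarith
  have hsm : StrictMonoOn E D := by
    intro x hx y hy hxy
    let P : ℕ → Prop := fun n => ∃ i : Fin ℓ,
      Int.fract (x + n * θ₀) ∈ Set.Ioo (t i.castSucc) (t i.succ) ∧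
      Int.fract (y + n * θ₀) ∈ Set.Ioo (t i.castSucc) (t i.succ)
    have hdiff : ∀ N : ℕ, (∀ n < N, P n) →
        Int.fract (y + N * θ₀) = Int.fract (x + N * θ₀) + (y - x) := by
      intro N
      induction N with
      | zero =>
        intro _
        have hx' := hDI x hx
        have hy' := hDI y hy
        simp only [Nat.cast_zero, zero_mul, add_zero]
        rw [Int.fract_eq_self.2 ⟨hx'.1.le, hx'.2⟩, Int.fract_eq_self.2 ⟨hy'.1.le, hy'.2⟩]
        ring
      | succ N ih =>
        intro h
        have ih' := ih (fun n hn => h n (by omega))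
        obtain ⟨i, h1, h2⟩ := h N (by omega)
        have hs := hside i _ _ h1 h2
        rw [hstep x N, hstep y N]
        simp only [hs]
        linarith
    have hex : ∃ N, ¬ P N := by
      by_contra hcon
      push Not at hcon
      have hu : max 0 (t m - (y - x)) < t m := max_lt hm0' (by linarith)
      obtain ⟨n, hn⟩ := cm_dense hθ x _ _ (le_max_left _ _) hu hm1'.le
      have h1 := hdiff n (fun j _ => hcon j)
      obtain ⟨i, h2, h3⟩ := hcon n
      have h4 := (hside i _ _ h2 h3).1 hn.2
      have h5 := lt_of_le_of_lt (le_max_right 0 (t m - (y - x))) hn.1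
      linarith
    classical
    obtain ⟨N, hN, hmin⟩ : ∃ N, ¬ P N ∧ ∀ n < N, P n :=
      ⟨Nat.find hex, Nat.find_spec hex, fun n hn => not_not.1 (Nat.find_min hex hn)⟩
    have hlt := hdiff N hmin
    rw [hE x, hE y]
    refine cm_lt hd N (hdigle x hx) (hdigle y hy) ?_ ?_ (hpos y hy N)
    · intro n hn
      obtain ⟨i, h1, h2⟩ := hmin n hn
      rw [hdig x hx n i h1, hdig y hy n i h2]
    · obtain ⟨i, hi⟩ := hloc x hx N
      obtain ⟨j, hj⟩ := hloc y hy N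
      rw [hdig x hx N i hi, hdig y hy N j hj]
      apply hk
      rcases lt_trichotomy i j with h | h | h
      · exact h
      · subst h
        exact absurd ⟨i, hi, hj⟩ hN
      · have : t j.succ ≤ t i.castSucc := hmono.monotone (by
          rw [Fin.le_def]; rw [Fin.lt_def] at h; simp; omega)
        linarith [hi.1, hj.2]
  refine ⟨?_, hsm.injOn, hsm, ?_⟩
  · rw [show E = fun ω => ∑' n : ℕ, (dig ω n : ℝ) / d ^ (n + 1) from funext hE]
    refine continuousOn_tsum (u := fun n : ℕ => ((d:ℝ) - 1) / d ^ (n + 1)) ?_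
      (cm_geom hd).summable ?_
    · intro n ω hω
      obtain ⟨i, hi⟩ := hloc ω hω n
      have hc : ContinuousAt (fun w : ℝ => Int.fract (w + n * θ₀)) ω := by
        have h1 : ContinuousAt (Int.fract : ℝ → ℝ) (ω + n * θ₀) := by
          apply continuousAt_fract
          intro h
          apply hne ω hω n 0
          rw [ht0, Int.fract, sub_eq_zero]
          exact h
        exact ContinuousAt.comp (f := fun w : ℝ => w + n * θ₀) h1 (by fun_prop)
      have hev := hc.eventually (isOpen_Ioo.mem_nhds hi)
      refine ContinuousWithinAt.congr_of_eventuallyEq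
        (f := fun _ => (dig ω n : ℝ) / d ^ (n + 1)) continuousWithinAt_const ?_ rfl
      filter_upwards [nhdsWithin_le_nhds hev, self_mem_nhdsWithin] with w hw hwD
      rw [hdig w hwD n i hw, hdig ω hω n i hi]
    · intro n ω hω
      rw [Real.norm_of_nonneg (by positivity)]
      exact cm_term_le hd (hdigle ω hω n) n
  · intro ω hω
    have hcoe : ∀ n : ℕ, ((Int.fract (ω + θ₀) + n * θ₀ : ℝ) : UnitAddCircle) =
        ((ω + (n + 1 : ℕ) * θ₀ : ℝ) : UnitAddCircle) := by
      intro n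
      rw [AddCircle.coe_add, AddCircle.coe_fract, ← AddCircle.coe_add]
      congr 1
      push_cast
      ring
    have hτ : Int.fract (ω + θ₀) ∈ D := by
      rw [hD]
      refine ⟨⟨Int.fract_nonneg _, (Int.fract_lt_one _).le⟩, fun n i => ?_⟩
      rw [hcoe]
      rw [hD] at hω
      exact hω.2 (n + 1) i
    have hs : ∀ n, dig (Int.fract (ω + θ₀)) n = dig ω (n + 1) := by
      intro n
      obtain ⟨i, hi⟩ := hloc ω hω (n + 1)
      rw [hdig ω hω _ i hi]
      apply hdig _ hτ n i
      rw [cm_fract_eq (hcoe n)]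
      exact hi
    have := cm_shift hd (hdigle ω hω)
    rw [← AddCircle.coe_nsmul, nsmul_eq_mul, hE ω, this, hE (Int.fract (ω + θ₀))]
    simp only [hs]
    rw [AddCircle.coe_add]
    have : (((dig ω 0 : ℕ) : ℝ) : UnitAddCircle) = 0 := by
      have h : Int.fract ((dig ω 0 : ℕ) : ℝ) = 0 := Int.fract_natCast _
      rw [← AddCircle.coe_fract, h]
      simp
    rw [this, zero_add]
end
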